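/- Let w ∈ ℂ, α ∈ ℝ, β > 0 and v = α + iβ, and let I = (1+wj)⁻¹·(−i)·(1+wj) ∈ 𝕊 (quaternion product). Then (1+wj)·P(α+βI) = (conj(ĝ(v)) − w·conj(h(v))) + (conj(ĥ(v)) + w·conj(g(v)))·j. (This identity gives the parameterisation of the twistor lift of P on the lower half 𝒬⁻ of the Segre quadric.) -/

import Mathlib

/-- The quaternion imaginary unit `i`. -/
noncomputable def qi : Quaternion ℝ := ⟨0, 1, 0, 0⟩

/-- The quaternion imaginary unit `j`. -/
noncomputable def qj : Quaternion ℝ := ⟨0, 0, 1, 0⟩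

/-- Identification of ℂ with the slice ℂ_i of the quaternions. -/
noncomputable def cq (z : ℂ) : Quaternion ℝ := ⟨z.re, z.im, 0, 0⟩

/-- The slice-polynomial function associated with `g, h, g', h'` at `α + βI` (`β > 0`). -/
noncomputable def Pslice (g h g' h' : Polynomial ℂ) (α β : ℝ) (I : Quaternion ℝ) : Quaternion ℝ :=
  ((1 - I * qi) / 2) * (cq (g.eval ⟨α, β⟩) + cq (h.eval ⟨α, β⟩) * qj) +
  ((1 + I * qi) / 2) *
    (cq ((starRingEnd ℂ) (g'.eval ⟨α, β⟩)) + cq ((starRingEnd ℂ) (h'.eval ⟨α, β⟩)) * qj)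

@[simp] theorem qi_re : qi.re = 0 := rfl
@[simp] theorem qi_imI : qi.imI = 1 := rfl
@[simp] theorem qi_imJ : qi.imJ = 0 := rfl
@[simp] theorem qi_imK : qi.imK = 0 := rfl
@[simp] theorem qj_re : qj.re = 0 := rfl
@[simp] theorem qj_imI : qj.imI = 0 := rfl
@[simp] theorem qj_imJ : qj.imJ = 1 := rfl
@[simp] theorem qj_imK : qj.imK = 0 := rfl
@[simp] theorem cq_re (z : ℂ) : (cq z).re = z.re := rfl
@[simp] theorem cq_imI (z : ℂ) : (cq z).imI = z.im := rfl
@[simp] theorem cq_imJ (z : ℂ) : (cq z).imJ = 0 := rfl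
@[simp] theorem cq_imK (z : ℂ) : (cq z).imK = 0 := rfl

theorem one_add_cq_mul_qj_ne_zero (w : ℂ) : 1 + cq w * qj ≠ 0 := by
  intro h
  have hre : (1 + cq w * qj).re = (0 : Quaternion ℝ).re := by rw [h]
  simp [Quaternion.re_one, Quaternion.re_zero] at hre

theorem qi_conj_one_add_cq_mul_qj (w : ℂ) :
    qi * (1 + cq w * qj) * qi = cq w * qj - 1 := by
  apply Quaternion.ext <;> simp [Quaternion.imJ_one, Quaternion.imK_one]

theorem cq_mul_qj_mul (w a b : ℂ) :
    cq w * qj * (cq a + cq b * qj) =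
      cq (-(w * (starRingEnd ℂ) b)) + cq (w * (starRingEnd ℂ) a) * qj := by
  apply Quaternion.ext <;> simp <;> ring

theorem cq_add (a b : ℂ) : cq (a + b) = cq a + cq b := by
  apply Quaternion.ext <;> simp

/-- Parameterisation of the twistor lift of `P` on the lower half of the Segre quadric:
for `I = (1+wj)⁻¹·(−i)·(1+wj)` one has
`(1+wj)·P(α+βI) = (conj ĝ(v) − w·conj h(v)) + (conj ĥ(v) + w·conj g(v))·j`. -/
theorem twistor_lift_lower_quadric (g h g' h' : Polynomial ℂ) (w : ℂ) (α β : ℝ)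
    (hβ : 0 < β) :
    (1 + cq w * qj) *
        Pslice g h g' h' α β ((1 + cq w * qj)⁻¹ * (-qi) * (1 + cq w * qj)) =
      cq ((starRingEnd ℂ) (g'.eval ⟨α, β⟩) - w * (starRingEnd ℂ) (h.eval ⟨α, β⟩)) +
        cq ((starRingEnd ℂ) (h'.eval ⟨α, β⟩) + w * (starRingEnd ℂ) (g.eval ⟨α, β⟩)) * qj := by
  have hq := one_add_cq_mul_qj_ne_zero w
  have hi := qi_conj_one_add_cq_mul_qj w
  have hc := cq_mul_qj_mul w (g.eval ⟨α, β⟩) (h.eval ⟨α, β⟩)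
  have h2 : (2 : Quaternion ℝ) ≠ 0 := by
    have : ((2 : ℝ) : Quaternion ℝ) ≠ 0 := by
      rw [← Quaternion.coe_zero]
      exact Quaternion.coe_injective.ne two_ne_zero
    exact_mod_cast this
  rw [Pslice, sub_eq_add_neg ((starRingEnd ℂ) _), cq_add, cq_add]
  generalize cq (g.eval ⟨α, β⟩) + cq (h.eval ⟨α, β⟩) * qj = A at *
  set q := 1 + cq w * qj with hqdef
  have hI : q * (q⁻¹ * (-qi) * q * qi) = 1 - cq w * qj := by
    rw [mul_assoc q⁻¹, mul_assoc q⁻¹, mul_inv_cancel_left₀ hq, neg_mul, neg_mul, hi, neg_sub]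
  have hminus : q * ((1 - q⁻¹ * (-qi) * q * qi) / 2) = cq w * qj := by
    rw [← mul_div_assoc, mul_sub, hI, mul_one, hqdef, div_eq_iff h2, mul_two]
    abel
  have hplus : q * ((1 + q⁻¹ * (-qi) * q * qi) / 2) = 1 := by
    rw [← mul_div_assoc, mul_add, hI, mul_one, hqdef, div_eq_iff h2, one_mul,
      ← one_add_one_eq_two]
    abel
  rw [mul_add, ← mul_assoc, ← mul_assoc, hminus, hplus, one_mul, hc, add_mul]
  abel
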